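/- Let ℬ ⊆ 𝒫(n) be a simply rooted family with |ℬ| = m, and let 𝒟 be a down-set contained in ℬ. Then ‖ℬ‖ ≤ ‖I(m)‖ + m − |𝒟|. -/

import Mathlib

open Finset
open scoped Classical

/-- The total size `‖𝒜‖ = Σ_{A∈𝒜} |A|` of a family of finite sets. -/
def totalSize (𝒜 : Finset (Finset ℕ)) : ℕ := ∑ A ∈ 𝒜, A.card

/-- A family is union-closed if it is closed under pairwise unions. -/
def UnionClosed (𝒜 : Finset (Finset ℕ)) : Prop := ∀ A ∈ 𝒜, ∀ B ∈ 𝒜, A ∪ B ∈ 𝒜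

/-- The `k`-th finite set of positive integers in the colex order: the positive
integer `i` belongs to it iff bit `i - 1` of `k` is set. -/
def colexSet (k : ℕ) : Finset ℕ :=
  ((Finset.range (k + 1)).filter fun i => k.testBit i).image (· + 1)

/-- The initial segment `I(m)` of length `m` of the colex order on finite sets
of positive integers. -/
def colexInit (m : ℕ) : Finset (Finset ℕ) := (Finset.range m).image colexSet

/-- A family `ℬ` is simply rooted if every nonempty `B ∈ ℬ` has some `b ∈ B`
with the whole cube `[{b}, B]` contained in `ℬ`. -/
def SimplyRooted (ℬ : Finset (Finset ℕ)) : Prop :=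
  ∀ B ∈ ℬ, B.Nonempty → ∃ b ∈ B, ∀ C : Finset ℕ, {b} ⊆ C → C ⊆ B → C ∈ ℬ

/-- `B` is `ℬ`-rooted at `i`: `i ∈ B` and the cube `[{i}, B]` lies in `ℬ`. -/
def RootedAt (ℬ : Finset (Finset ℕ)) (B : Finset ℕ) (i : ℕ) : Prop :=
  i ∈ B ∧ ∀ C : Finset ℕ, {i} ⊆ C → C ⊆ B → C ∈ ℬ

/-- `ℬ_S`: the sets of `ℬ` that are `ℬ`-rooted at some element of `S`. -/
noncomputable def rootedFam (ℬ : Finset (Finset ℕ)) (S : Finset ℕ) : Finset (Finset ℕ) :=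
  ℬ.filter fun B => ∃ i ∈ S, RootedAt ℬ B i

/-- The image of a single set `B` under the down-compression of `ℬ` in
direction `i`. -/
def compressSet (ℬ : Finset (Finset ℕ)) (i : ℕ) (B : Finset ℕ) : Finset ℕ :=
  if i ∈ B ∧ B.erase i ∉ ℬ then B.erase i else B

/-- The down-compression `d_i(ℬ)` of the family `ℬ` in direction `i`. -/
def dComp (i : ℕ) (ℬ : Finset (Finset ℕ)) : Finset (Finset ℕ) :=
  ℬ.image (compressSet ℬ i)

/-- `D_k(ℬ) = d_k(⋯ d_1(ℬ) ⋯)`.  In particular `d(ℬ) = D_n(ℬ)` for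
`ℬ ⊆ 𝒫(n)`. -/
def DComp : ℕ → Finset (Finset ℕ) → Finset (Finset ℕ)
  | 0, ℬ => ℬ
  | k + 1, ℬ => dComp (k + 1) (DComp k ℬ)

/-- `D_{(ℬ,k)}(B)`: the image of the set `B` obtained by following `B` through
the successive compressions `d_1, …, d_k`.  In particular `d_ℬ(B) = D_{(ℬ,n)}(B)`
for `ℬ ⊆ 𝒫(n)`. -/
def DCompSet : ℕ → Finset (Finset ℕ) → Finset ℕ → Finset ℕ
  | 0, _, B => B
  | k + 1, ℬ, B => compressSet (DComp k ℬ) (k + 1) (DCompSet k ℬ B)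

/-- The shadow `δB = {B \ {i} : i ∈ B}` of a finite set `B`. -/
def shadowSet (B : Finset ℕ) : Finset (Finset ℕ) := B.image fun i => B.erase i

/-- `B` is a bad set of `ℬ ⊆ 𝒫(n)` if `δB ⊆ ℬ` or `d_ℬ(B) = B`. -/
def BadSet (n : ℕ) (ℬ : Finset (Finset ℕ)) (B : Finset ℕ) : Prop :=
  shadowSet B ⊆ ℬ ∨ DCompSet n ℬ B = B

/-- A family is a down-set if it is closed under taking subsets. -/
def IsDownSet (𝒟 : Finset (Finset ℕ)) : Prop := ∀ A ∈ 𝒟, ∀ B ⊆ A, B ∈ 𝒟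

/-- The deficiency `def(ℬ) = Σ_{B∈ℬ} |δB \ ℬ|`. -/
def deficiency (ℬ : Finset (Finset ℕ)) : ℕ := ∑ B ∈ ℬ, (shadowSet B \ ℬ).card

/-- `𝒜 ⊆ 𝒫(n)` is a counterexample to the union-closed conjecture:
union-closed, not `{∅}`, and every element of `[n]` has degree `< |𝒜|/2`. -/
def UCCounterexample (n : ℕ) (𝒜 : Finset (Finset ℕ)) : Prop :=
  𝒜 ⊆ (Finset.Icc 1 n).powerset ∧ UnionClosed 𝒜 ∧ 𝒜 ≠ {∅} ∧
    ∀ i ∈ Finset.Icc 1 n, ((𝒜.filter fun A => i ∈ A).card : ℚ) < (𝒜.card : ℚ) / 2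

theorem succ_mem_colexSet (k i : ℕ) : i + 1 ∈ colexSet k ↔ k.testBit i = true := by
  have hlt : k.testBit i = true → i < k + 1 := fun h => by
    have := Nat.ge_two_pow_of_testBit h
    have := Nat.lt_two_pow_self (n := i)
    omega
  simpa [colexSet] using hlt

theorem zero_notMem_colexSet (k : ℕ) : 0 ∉ colexSet k := by
  simp [colexSet]

theorem colexSet_injective : Function.Injective colexSet := fun a b h =>
  Nat.eq_of_testBit_eq fun i => by
    rw [Bool.eq_iff_iff, ← succ_mem_colexSet, ← succ_mem_colexSet, h]

theorem totalSize_colexInit (m : ℕ) :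
    totalSize (colexInit m) = ∑ k ∈ range m, (colexSet k).card :=
  sum_image colexSet_injective.injOn

theorem colexSet_two_mul (k : ℕ) : colexSet (2 * k) = (colexSet k).image (· + 1) := by
  ext i
  rcases i with _ | _ | i
  · simp [zero_notMem_colexSet]
  · simp [succ_mem_colexSet, zero_notMem_colexSet]
  · simp [succ_mem_colexSet, Nat.testBit_succ]

theorem colexSet_two_mul_add_one (k : ℕ) :
    colexSet (2 * k + 1) = insert 1 ((colexSet k).image (· + 1)) := by
  ext i
  rcases i with _ | _ | i
  · simp [zero_notMem_colexSet]
  · simp [succ_mem_colexSet]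
  · have : (2 * k + 1) / 2 = k := by omega
    simp [succ_mem_colexSet, Nat.testBit_succ, this]

theorem card_colexSet_two_mul (k : ℕ) : (colexSet (2 * k)).card = (colexSet k).card := by
  rw [colexSet_two_mul, card_image_of_injective _ (add_left_injective 1)]

theorem card_colexSet_two_mul_add_one (k : ℕ) :
    (colexSet (2 * k + 1)).card = (colexSet k).card + 1 := by
  rw [colexSet_two_mul_add_one, card_insert_of_notMem (by simp [zero_notMem_colexSet]),
    card_image_of_injective _ (add_left_injective 1)]

theorem totalSize_colexInit_succ (m : ℕ) :
    totalSize (colexInit (m + 1)) = totalSize (colexInit m) + (colexSet m).card := by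
  rw [totalSize_colexInit, totalSize_colexInit, sum_range_succ]

theorem totalSize_colexInit_two_mul (m : ℕ) :
    totalSize (colexInit (2 * m)) = 2 * totalSize (colexInit m) + m := by
  induction m with
  | zero => simp [totalSize_colexInit]
  | succ m ih =>
    rw [Nat.mul_succ, totalSize_colexInit_succ, totalSize_colexInit_succ,
      totalSize_colexInit_succ, ih, card_colexSet_two_mul, card_colexSet_two_mul_add_one]
    ring

theorem totalSize_colexInit_two_mul_add_one (m : ℕ) :
    totalSize (colexInit (2 * m + 1)) =
      totalSize (colexInit m) + totalSize (colexInit (m + 1)) + m := by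
  rw [totalSize_colexInit_succ, totalSize_colexInit_two_mul, card_colexSet_two_mul,
    totalSize_colexInit_succ]
  ring

/-- The total size of colex initial segments is superadditive, with excess `min a b`. -/
theorem totalSize_colexInit_add_le (a b : ℕ) :
    totalSize (colexInit a) + totalSize (colexInit b) + min a b ≤
      totalSize (colexInit (a + b)) := by
  induction h : a + b using Nat.strong_induction_on generalizing a b with
  | _ s ih =>
    subst h
    have ih' (x y : ℕ) (h : x + y < a + b) := ih _ h x y rfl
    clear ih
    rcases Nat.eq_zero_or_pos a with rfl | ha
    · simp [totalSize_colexInit]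
    rcases Nat.eq_zero_or_pos b with rfl | hb
    · simp [totalSize_colexInit]
    obtain ⟨x, rfl | rfl⟩ := Nat.even_or_odd' a <;> obtain ⟨y, rfl | rfl⟩ := Nat.even_or_odd' b
    · have h := ih' x y (by omega)
      rw [← Nat.mul_add]
      simp only [totalSize_colexInit_two_mul]
      omega
    · have h₁ := ih' x y (by omega)
      have h₂ := ih' x (y + 1) (by omega)
      rw [← Nat.add_assoc, ← Nat.mul_add]
      rw [← Nat.add_assoc] at h₂
      simp only [totalSize_colexInit_two_mul, totalSize_colexInit_two_mul_add_one]
      omega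
    · have h₁ := ih' x y (by omega)
      have h₂ := ih' (x + 1) y (by omega)
      rw [Nat.add_right_comm (2 * x), ← Nat.mul_add]
      rw [Nat.add_right_comm x] at h₂
      simp only [totalSize_colexInit_two_mul, totalSize_colexInit_two_mul_add_one]
      omega
    · have h₁ := ih' x (y + 1) (by omega)
      have h₂ := ih' (x + 1) y (by omega)
      rw [show 2 * x + 1 + (2 * y + 1) = 2 * (x + y + 1) by ring]
      rw [← Nat.add_assoc] at h₁
      rw [Nat.add_right_comm x] at h₂
      simp only [totalSize_colexInit_two_mul, totalSize_colexInit_two_mul_add_one]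
      omega

/-- The number of edges of the hypercube induced by the family `𝒜`. -/
def inducedEdgeCount (𝒜 : Finset (Finset ℕ)) : ℕ :=
  ∑ A ∈ 𝒜, {i ∈ A | A.erase i ∈ 𝒜}.card

theorem inducedEdgeCount_eq (a : ℕ) (𝒜 : Finset (Finset ℕ)) :
    inducedEdgeCount 𝒜 = inducedEdgeCount (𝒜.memberSubfamily a) +
      inducedEdgeCount (𝒜.nonMemberSubfamily a) +
      (𝒜.memberSubfamily a ∩ 𝒜.nonMemberSubfamily a).card := by
  have hmem : ∑ A ∈ 𝒜 with a ∈ A, {i ∈ A | A.erase i ∈ 𝒜}.card =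
      ∑ A ∈ 𝒜.memberSubfamily a,
        ({i ∈ A | A.erase i ∈ 𝒜.memberSubfamily a}.card +
          if A ∈ 𝒜.nonMemberSubfamily a then 1 else 0) := by
    rw [memberSubfamily, sum_image (by
      intro A hA B hB h
      simp only [coe_filter, Set.mem_ofPred_eq] at hA hB
      exact erase_injOn' a hA.2 hB.2 h)]
    refine sum_congr rfl fun A hA => ?_
    have haA := (mem_filter.1 hA).2
    rw [← memberSubfamily, ← insert_erase haA, filter_insert, erase_insert (notMem_erase a A)]
    have hfilter : {i ∈ A.erase a | (insert a (A.erase a)).erase i ∈ 𝒜} =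
        {i ∈ A.erase a | (A.erase a).erase i ∈ 𝒜.memberSubfamily a} := by
      refine filter_congr fun i hi => ?_
      have hia : a ≠ i := (ne_of_mem_erase hi).symm
      rw [mem_memberSubfamily, erase_insert_of_ne hia]
      simp
    rw [hfilter]
    simp only [mem_nonMemberSubfamily, notMem_erase, not_false_eq_true, and_true]
    split_ifs
    · rw [card_insert_of_notMem (by simp)]
    · rw [add_zero]
  have hnon : ∑ A ∈ 𝒜 with a ∉ A, {i ∈ A | A.erase i ∈ 𝒜}.card =
      inducedEdgeCount (𝒜.nonMemberSubfamily a) := by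
    refine sum_congr rfl fun A hA => congrArg card (filter_congr fun i _ => ?_)
    have haA := (mem_filter.1 hA).2
    simp [mem_nonMemberSubfamily, haA]
  rw [inducedEdgeCount, ← sum_filter_add_sum_filter_not 𝒜 (a ∈ ·), hmem, hnon,
    sum_add_distrib, sum_boole, filter_mem_eq_inter, Nat.cast_id, Nat.add_right_comm]
  rfl

/-- The edge-isoperimetric inequality in the hypercube. -/
theorem inducedEdgeCount_le (S : Finset ℕ) (𝒜 : Finset (Finset ℕ)) (h𝒜 : 𝒜 ⊆ S.powerset) :
    inducedEdgeCount 𝒜 ≤ totalSize (colexInit 𝒜.card) := by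
  induction S using Finset.induction_on generalizing 𝒜 with
  | empty =>
    refine le_trans (le_of_eq (sum_eq_zero fun A hA => ?_)) (Nat.zero_le _)
    have hA' : A = ∅ := by simpa using h𝒜 hA
    simp [hA']
  | insert a S _ ih =>
    have hmem : 𝒜.memberSubfamily a ⊆ S.powerset := fun A hA => by
      rw [mem_memberSubfamily] at hA
      exact mem_powerset.2 ((insert_subset_insert_iff hA.2).1 (mem_powerset.1 (h𝒜 hA.1)))
    have hnon : 𝒜.nonMemberSubfamily a ⊆ S.powerset := fun A hA => by
      rw [mem_nonMemberSubfamily] at hA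
      exact mem_powerset.2 ((subset_insert_iff_of_notMem hA.2).1 (mem_powerset.1 (h𝒜 hA.1)))
    have h₁ := ih _ hmem
    have h₂ := ih _ hnon
    have h₃ := totalSize_colexInit_add_le (𝒜.memberSubfamily a).card
      (𝒜.nonMemberSubfamily a).card
    have h₄ := card_memberSubfamily_add_card_nonMemberSubfamily a 𝒜
    have h₅ := card_le_card (inter_subset_left (s₁ := 𝒜.memberSubfamily a)
      (s₂ := 𝒜.nonMemberSubfamily a))
    have h₆ := card_le_card (inter_subset_right (s₁ := 𝒜.memberSubfamily a)
      (s₂ := 𝒜.nonMemberSubfamily a))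
    rw [inducedEdgeCount_eq a]
    rw [h₄] at h₃
    omega

/-- In a simply rooted family at most one lower neighbour of each member is missing. -/
theorem SimplyRooted.card_erase_notMem_le_one {ℬ : Finset (Finset ℕ)} (h : SimplyRooted ℬ)
    {B : Finset ℕ} (hB : B ∈ ℬ) : {i ∈ B | B.erase i ∉ ℬ}.card ≤ 1 := by
  rcases B.eq_empty_or_nonempty with rfl | hne
  · simp
  obtain ⟨b, hb, hcube⟩ := h B hB hne
  refine (card_le_card (t := {b}) fun i hi => ?_).trans (card_singleton b).le
  rw [mem_filter] at hi
  rw [mem_singleton]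
  by_contra hib
  exact hi.2 (hcube _ (singleton_subset_iff.2 (mem_erase.2 ⟨Ne.symm hib, hb⟩)) (erase_subset i B))

/-- For a simply rooted family `ℬ ⊆ 𝒫(n)` with `|ℬ| = m` and a
down-set `𝒟 ⊆ ℬ`, we have `‖ℬ‖ ≤ ‖I(m)‖ + m - |𝒟|`. -/
theorem stmt13 (n : ℕ) (ℬ 𝒟 : Finset (Finset ℕ)) (hsub : ℬ ⊆ (Finset.Icc 1 n).powerset)
    (hsr : SimplyRooted ℬ) (m : ℕ) (hm : m = ℬ.card)
    (hD : 𝒟 ⊆ ℬ) (hdown : IsDownSet 𝒟) :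
    (totalSize ℬ : ℤ) ≤ (totalSize (colexInit m) : ℤ) + (m : ℤ) - (𝒟.card : ℤ) := by
  subst hm
  have hsplit : totalSize ℬ =
      inducedEdgeCount ℬ + ∑ B ∈ ℬ, {i ∈ B | B.erase i ∉ ℬ}.card := by
    rw [totalSize, inducedEdgeCount, ← sum_add_distrib]
    exact sum_congr rfl fun B _ => (card_filter_add_card_filter_not _).symm
  have hmissing : ∑ B ∈ ℬ, {i ∈ B | B.erase i ∉ ℬ}.card ≤ (ℬ \ 𝒟).card := by
    rw [← sum_sdiff hD, sum_eq_zero (s := 𝒟), add_zero, card_eq_sum_ones]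
    · exact sum_le_sum fun B hB => hsr.card_erase_notMem_le_one (mem_sdiff.1 hB).1
    · intro B hB
      rw [card_eq_zero, filter_eq_empty_iff]
      exact fun i _ hi => hi (hD (hdown B hB _ (erase_subset i B)))
  have hedges := inducedEdgeCount_le _ ℬ hsub
  have hcard := card_sdiff_add_card_eq_card hD
  omega
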